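/- Let n, d be positive integers with nd even, let G be a uniformly random perfect matching drawn from M_{n,d}, and let q satisfy 2dq < nd − 1. Fix a deterministic adaptive algorithm making q group-incidence queries that then outputs a meta-path from s = 1 to t = n. Let τ be any transcript of queries and answers occurring with positive probability in which the discovered edges do not connect s and t (there is no sequence of group indices from 1 to n with every consecutive pair of groups joined by a discovered edge). Then, conditioned on the algorithm producing transcript τ, the probability that the output meta-path is valid is at most d²/(nd − 1 − 2dq). -/

import Mathlib

/-- `M_{n,d}`: perfect matchings on the vertex set `[n] × [d]`, encoded as fixed-point-free
involutions (each vertex is matched to its image).  The set `{i} × [d]` is called group `i`. -/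
abbrev PMatching (n d : ℕ) :=
  {f : Fin n × Fin d → Fin n × Fin d // Function.Involutive f ∧ ∀ x, f x ≠ x}

/-- The probability of the event `E` for a uniformly random perfect matching
drawn from `M_{n,d}`. -/
noncomputable def mProb (n d : ℕ) (E : PMatching n d → Prop) : ℝ :=
  (Nat.card {f : PMatching n d // E f} : ℝ) / (Nat.card (PMatching n d) : ℝ)

/-- A deterministic adaptive group-incidence query algorithm: `nextQuery` selects the next
group to query from the transcript so far (the list of queried groups together with the
answers; the answer to a query at group `i` is the set of matching edges incident to group
`i`, recorded as the function `j ↦ f (i, j)`), and `output` produces a sequence of group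
indices (a meta-path) from the full transcript. -/
structure MAlgo (n d : ℕ) where
  nextQuery : List (Fin n × (Fin d → Fin n × Fin d)) → Fin n
  output : List (Fin n × (Fin d → Fin n × Fin d)) → List (Fin n)

/-- The transcript of the first `q` group-incidence queries of `A` run on the matching `f`. -/
def mRun {n d : ℕ} (A : MAlgo n d) (f : PMatching n d) :
    ℕ → List (Fin n × (Fin d → Fin n × Fin d))
  | 0 => []
  | q + 1 =>
      let h := mRun A f q
      h ++ [(A.nextQuery h, fun j => f.1 (A.nextQuery h, j))]

/-- Groups `a` and `b` are joined by a matching edge of `f`: some vertex of group `a` is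
matched to a vertex of group `b`. -/
def metaAdj {n d : ℕ} (f : PMatching n d) (a b : Fin n) : Prop :=
  ∃ j : Fin d, (f.1 (a, j)).1 = b

/-- `L` is a valid `s`-`t` meta-path in the matching `f`: a sequence of group indices
starting at `s` and ending at `t` such that every two consecutive groups are joined by a
matching edge. -/
def IsValidMeta {n d : ℕ} (f : PMatching n d) (s t : Fin n) (L : List (Fin n)) : Prop :=
  L.head? = some s ∧ L.getLast? = some t ∧ L.Chain' (metaAdj f)

/-- Groups `a` and `b` are joined by an edge discovered in the transcript `h`. -/
def discMetaAdj {n d : ℕ} (h : List (Fin n × (Fin d → Fin n × Fin d))) (a b : Fin n) : Prop :=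
  ∃ e ∈ h, ∃ j : Fin d, (e.1 = a ∧ (e.2 j).1 = b) ∨ (e.1 = b ∧ (e.2 j).1 = a)

theorem aux_chain {α : Type*} (R : α → α → Prop) (t : α) : ∀ (L : List α) (s : α),
    L.head? = some s → L.getLast? = some t → ¬ Relation.ReflTransGen R s t →
    ∃ a b, ¬ R a b ∧ ∀ P : α → α → Prop, L.IsChain P → P a b := by
  intro L
  induction L with
  | nil => intro s h; simp at h
  | cons x L ih =>
    intro s hs ht hR
    have hx : x = s := by simpa using hs
    subst hx
    cases L with
    | nil =>
      have : x = t := by simpa using ht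
      subst this
      exact absurd Relation.ReflTransGen.refl hR
    | cons y L =>
      by_cases hxy : R x y
      · obtain ⟨a, b, h1, h2⟩ := ih y (by simp) (by simpa using ht)
          (fun h => hR (Relation.ReflTransGen.head hxy h))
        exact ⟨a, b, h1, fun P hP => h2 P (List.isChain_cons_cons.1 hP).2⟩
      · exact ⟨x, y, hxy, fun P hP => (List.isChain_cons_cons.1 hP).1⟩

theorem aux_len {n d : ℕ} (A : MAlgo n d) (f : PMatching n d) (q : ℕ) :
    (mRun A f q).length = q := by
  induction q with
  | zero => rfl
  | succ q ih => simp [mRun, ih]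

theorem aux_mem {n d : ℕ} (A : MAlgo n d) (f : PMatching n d) (q : ℕ) :
    ∀ e ∈ mRun A f q, ∀ j, f.1 (e.1, j) = e.2 j := by
  induction q with
  | zero => intro e he; simp [mRun] at he
  | succ q ih =>
    intro e he j
    simp only [mRun, List.mem_append, List.mem_singleton] at he
    rcases he with he | he
    · exact ih e he j
    · subst he; rfl

theorem aux_congr {n d : ℕ} (A : MAlgo n d) (f g : PMatching n d) (q : ℕ)
    (h : ∀ e ∈ mRun A f q, ∀ j, g.1 (e.1, j) = f.1 (e.1, j)) : mRun A g q = mRun A f q := by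
  induction q with
  | zero => rfl
  | succ q ih =>
    have h0 := ih (fun e he j => h e (by simp [mRun, he]) j)
    have h1 := h (A.nextQuery (mRun A f q), fun j => f.1 (A.nextQuery (mRun A f q), j))
      (by simp [mRun])
    simp only [mRun, h0]
    congr 3
    funext j
    exact h1 j

/-- vertices touched by a transcript -/
def touched {n d : ℕ} (τ : List (Fin n × (Fin d → Fin n × Fin d))) : Finset (Fin n × Fin d) :=
  (τ.flatMap fun e => (List.finRange d).flatMap fun j => [(e.1, j), e.2 j]).toFinset

theorem aux_touched {n d : ℕ} (τ : List (Fin n × (Fin d → Fin n × Fin d))) (x : Fin n × Fin d) :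
    x ∈ touched τ ↔ ∃ e ∈ τ, ∃ j, x = (e.1, j) ∨ x = e.2 j := by
  simp [touched]

theorem aux_card {n d : ℕ} (τ : List (Fin n × (Fin d → Fin n × Fin d))) :
    (touched τ).card ≤ 2 * d * τ.length := by
  refine (List.toFinset_card_le _).trans (le_of_eq ?_)
  simp [List.length_flatMap]
  ring

theorem aux_adj {n d : ℕ} (τ : List (Fin n × (Fin d → Fin n × Fin d))) (f : PMatching n d)
    (hf : ∀ e ∈ τ, ∀ j, f.1 (e.1, j) = e.2 j) (x : Fin n × Fin d) (hx : x ∈ touched τ) :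
    f.1 x ∈ touched τ ∧ discMetaAdj τ x.1 (f.1 x).1 := by
  obtain ⟨e, he, j, h | h⟩ := (aux_touched τ x).1 hx
  · subst h
    rw [hf e he j]
    exact ⟨(aux_touched τ _).2 ⟨e, he, j, Or.inr rfl⟩, e, he, j, Or.inl ⟨rfl, rfl⟩⟩
  · have : f.1 x = (e.1, j) := by rw [h, ← hf e he j, f.2.1]
    rw [this]
    exact ⟨(aux_touched τ _).2 ⟨e, he, j, Or.inl rfl⟩, e, he, j, Or.inr ⟨rfl, by rw [h]⟩⟩

/-- conjugation of a matching by a transposition -/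
def conjM {n d : ℕ} (v w : Fin n × Fin d) (f : PMatching n d) : PMatching n d :=
  ⟨fun x => Equiv.swap v w (f.1 (Equiv.swap v w x)), by
    refine ⟨fun x => ?_, fun x hx => ?_⟩
    · simp [f.2.1 _]
    · apply f.2.2 (Equiv.swap v w x)
      have := congrArg (Equiv.swap v w) hx
      simpa using this⟩

theorem conjM_conjM {n d : ℕ} (v w : Fin n × Fin d) (f : PMatching n d) :
    conjM v w (conjM v w f) = f := by
  apply Subtype.ext
  funext x
  simp [conjM]

open Classical in
theorem aux_swap {n d q : ℕ} (A : MAlgo n d) (τ : List (Fin n × (Fin d → Fin n × Fin d)))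
    (u v w : Fin n × Fin d) (hv : v ∉ touched τ) (hw : w ∉ touched τ) (huv : u ≠ v)
    (huw : u ≠ w) :
    (Finset.univ.filter fun f : PMatching n d => mRun A f q = τ ∧ f.1 u = v).card ≤
    (Finset.univ.filter fun f : PMatching n d => mRun A f q = τ ∧ f.1 u = w).card := by
  apply Finset.card_le_card_of_injOn (conjM v w)
  · intro f hf
    simp only [Finset.coe_filter, Finset.mem_univ, true_and, Set.mem_ofPred_eq] at hf ⊢
    obtain ⟨h1, h2⟩ := hf
    have hm := aux_mem A f q
    rw [h1] at hm
    have hfix : ∀ x ∈ touched τ, Equiv.swap v w x = x := fun x hx =>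
      Equiv.swap_apply_of_ne_of_ne (fun h => hv (h ▸ hx)) (fun h => hw (h ▸ hx))
    constructor
    · rw [← h1]
      apply aux_congr
      rw [h1]
      intro e he j
      have hx : (e.1, j) ∈ touched τ := (aux_touched τ _).2 ⟨e, he, j, Or.inl rfl⟩
      simp only [conjM]
      rw [hfix _ hx, hfix _ (aux_adj τ f hm _ hx).1]
    · simp only [conjM]
      rw [Equiv.swap_apply_of_ne_of_ne huv huw, h2, Equiv.swap_apply_left]
  · intro f _ g _ h
    have := congrArg (conjM v w) h
    simpa [conjM_conjM] using this

open Classical in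
theorem aux_count {n d q : ℕ} (A : MAlgo n d) (τ : List (Fin n × (Fin d → Fin n × Fin d)))
    (hτ : τ.length = q)
    (u v : Fin n × Fin d) (hv : v ∉ touched τ) :
    ((n : ℝ) * d - 1 - 2 * d * q) *
      (Finset.univ.filter fun f : PMatching n d => mRun A f q = τ ∧ f.1 u = v).card ≤
    (Finset.univ.filter fun f : PMatching n d => mRun A f q = τ).card := by
  by_cases huv : u = v
  · have : (Finset.univ.filter fun f : PMatching n d => mRun A f q = τ ∧ f.1 u = v) = ∅ := by
      apply Finset.filter_eq_empty_iff.2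
      rintro f - ⟨-, h⟩
      exact f.2.2 u (h.trans huv.symm)
    rw [this]; simp
  set N := (Finset.univ.filter fun f : PMatching n d => mRun A f q = τ ∧ f.1 u = v).card
  set W : Finset (Fin n × Fin d) := Finset.univ \ (insert u (touched τ))
  have h1 : W.card * N ≤ (Finset.univ.filter fun f : PMatching n d => mRun A f q = τ).card := by
    calc W.card * N = ∑ w ∈ W, N := by simp
      _ ≤ ∑ w ∈ W, ((Finset.univ.filter fun f : PMatching n d => mRun A f q = τ).filter
            fun f => f.1 u = w).card := by
          apply Finset.sum_le_sum
          intro w hw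
          rw [Finset.filter_filter]
          simp only [W, Finset.mem_sdiff, Finset.mem_univ, true_and, Finset.mem_insert,
            not_or] at hw
          exact aux_swap A τ u v w hv hw.2 huv (Ne.symm hw.1)
      _ ≤ _ := by
          rw [← Finset.card_biUnion]
          · exact Finset.card_le_card (Finset.biUnion_subset.2 fun w _ => Finset.filter_subset _ _)
          · intro x _ y _ hxy
            apply Finset.disjoint_left.2
            intro f hf hg
            exact hxy ((Finset.mem_filter.1 hf).2.symm.trans (Finset.mem_filter.1 hg).2)
  have h2 : n * d ≤ W.card + (2 * d * q + 1) := by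
    have h3 := Finset.card_sdiff_add_card (Finset.univ : Finset (Fin n × Fin d))
      (insert u (touched τ))
    have h4 := Finset.card_insert_le u (touched τ)
    have h5 := aux_card τ
    rw [hτ] at h5
    have h6 : (Finset.univ ∪ insert u (touched τ)).card = n * d := by
      rw [Finset.union_eq_left.2 (Finset.subset_univ _)]; simp
    have h7 : W.card = (Finset.univ \ (insert u (touched τ))).card := rfl
    omega
  have h1' : (W.card : ℝ) * N ≤
    (Finset.univ.filter fun f : PMatching n d => mRun A f q = τ).card := by exact_mod_cast h1
  have h2' : (n : ℝ) * d ≤ W.card + (2 * d * q + 1) := by exact_mod_cast h2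
  refine le_trans ?_ h1'
  gcongr
  linarith

/-- Let `n, d ≥ 1` with `nd` even, let `G` be a uniformly random perfect matching from
`M_{n,d}`, let `q` satisfy `2dq < nd − 1`, and fix a deterministic adaptive algorithm
making `q` group-incidence queries that outputs a meta-path from `s = 1` (group `0` of
`Fin n`) to `t = n` (group `n−1`).  If `τ` is a transcript occurring with positive
probability in which the discovered edges do not connect `s` and `t`, then, conditioned on
the transcript being `τ`, the output meta-path is valid with probability at most
`d²/(nd − 1 − 2dq)` (stated as:
`Pr[transcript = τ ∧ output valid] ≤ d²/(nd − 1 − 2dq) · Pr[transcript = τ]`). -/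
theorem stmt14 (n d q : ℕ) (hn : 0 < n) (hd : 0 < d) (heven : Even (n * d))
    (hq : (2 * d * q : ℝ) < (n : ℝ) * d - 1) (A : MAlgo n d)
    (τ : List (Fin n × (Fin d → Fin n × Fin d)))
    (hpos : 0 < mProb n d (fun f => mRun A f q = τ))
    (hdisc : ¬Relation.ReflTransGen (discMetaAdj τ) ⟨0, by omega⟩ ⟨n - 1, by omega⟩) :
    mProb n d (fun f => mRun A f q = τ ∧
        IsValidMeta f ⟨0, by omega⟩ ⟨n - 1, by omega⟩ (A.output τ))
      ≤ (d : ℝ) ^ 2 / ((n : ℝ) * d - 1 - 2 * d * q)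
        * mProb n d (fun f => mRun A f q = τ) := by
  classical
  have hmp : ∀ (E : PMatching n d → Prop) [DecidablePred E], mProb n d E =
      ((Finset.univ.filter E).card : ℝ) / (Nat.card (PMatching n d) : ℝ) := by
    intro E _
    rw [mProb, Nat.card_eq_fintype_card, Fintype.card_subtype]
  have hD : (0 : ℝ) < (n : ℝ) * d - 1 - 2 * d * q := by linarith
  have hτ : τ.length = q := by
    by_contra hne
    have : (Finset.univ.filter fun f : PMatching n d => mRun A f q = τ) = ∅ := by
      apply Finset.filter_eq_empty_iff.2
      rintro f - h
      exact hne (h ▸ aux_len A f q)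
    rw [hmp, this] at hpos
    simp at hpos
  rw [hmp, hmp, ← mul_div_assoc]
  apply div_le_div_of_nonneg_right _ (Nat.cast_nonneg _)
  rw [div_mul_eq_mul_div, le_div_iff₀ hD]
  by_cases hL : (A.output τ).head? = some (⟨0, by omega⟩ : Fin n) ∧
      (A.output τ).getLast? = some (⟨n - 1, by omega⟩ : Fin n)
  swap
  · have : (Finset.univ.filter fun f : PMatching n d => mRun A f q = τ ∧
        IsValidMeta f ⟨0, by omega⟩ ⟨n - 1, by omega⟩ (A.output τ)) = ∅ := by
      apply Finset.filter_eq_empty_iff.2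
      rintro f - ⟨-, h1, h2, -⟩
      exact hL ⟨h1, h2⟩
    rw [this]
    simp only [Finset.card_empty, Nat.cast_zero, zero_mul]
    positivity
  obtain ⟨a, b, hab, hP⟩ := aux_chain (discMetaAdj τ) _ _ _ hL.1 hL.2 hdisc
  set T : Finset (Fin d × Fin d) := Finset.univ.filter fun p => (b, p.2) ∉ touched τ
  have hsub : (Finset.univ.filter fun f : PMatching n d => mRun A f q = τ ∧
        IsValidMeta f ⟨0, by omega⟩ ⟨n - 1, by omega⟩ (A.output τ)) ⊆
      T.biUnion fun p => Finset.univ.filter fun f : PMatching n d =>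
        mRun A f q = τ ∧ f.1 (a, p.1) = (b, p.2) := by
    intro f hf
    simp only [Finset.mem_filter, Finset.mem_univ, true_and] at hf
    obtain ⟨hr, -, -, hc⟩ := hf
    obtain ⟨j, hj⟩ := hP _ hc
    have hm := aux_mem A f q
    rw [hr] at hm
    have hfe : f.1 (a, j) = (b, (f.1 (a, j)).2) := Prod.ext hj rfl
    simp only [Finset.mem_biUnion, Finset.mem_filter, Finset.mem_univ, true_and, T]
    refine ⟨(j, (f.1 (a, j)).2), ?_, hr, hfe⟩
    intro hmem
    rw [← hfe] at hmem
    have h1 := (aux_adj τ f hm _ hmem).1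
    rw [f.2.1] at h1
    have h2 := (aux_adj τ f hm _ h1).2
    rw [hj] at h2
    exact hab h2
  have hT : T.card ≤ d ^ 2 := by
    refine (Finset.card_filter_le _ _).trans (le_of_eq ?_)
    simp [sq]
  have hle := (Finset.card_le_card hsub).trans Finset.card_biUnion_le
  have hle' : ((Finset.univ.filter fun f : PMatching n d => mRun A f q = τ ∧
        IsValidMeta f ⟨0, by omega⟩ ⟨n - 1, by omega⟩ (A.output τ)).card : ℝ) ≤
      ∑ p ∈ T, ((Finset.univ.filter fun f : PMatching n d =>
        mRun A f q = τ ∧ f.1 (a, p.1) = (b, p.2)).card : ℝ) := by exact_mod_cast hle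
  have hT' : (T.card : ℝ) ≤ (d : ℝ) ^ 2 := by exact_mod_cast hT
  calc _ ≤ (∑ p ∈ T, ((Finset.univ.filter fun f : PMatching n d =>
        mRun A f q = τ ∧ f.1 (a, p.1) = (b, p.2)).card : ℝ)) *
          ((n : ℝ) * d - 1 - 2 * d * q) := mul_le_mul_of_nonneg_right hle' hD.le
    _ ≤ ∑ p ∈ T, ((Finset.univ.filter fun f : PMatching n d => mRun A f q = τ).card : ℝ) := by
        rw [Finset.sum_mul]
        apply Finset.sum_le_sum
        intro p hp
        rw [mul_comm]
        convert aux_count A τ hτ (a, p.1) (b, p.2) (by simpa [T] using hp)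
    _ = T.card * ((Finset.univ.filter fun f : PMatching n d => mRun A f q = τ).card : ℝ) := by
        simp
    _ ≤ _ := mul_le_mul_of_nonneg_right hT' (Nat.cast_nonneg _)
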